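/- For all n ≥ 0 and k ≥ 1, the number of Schröder words of semilength n avoiding the pattern H^k (k consecutive H steps) equals Σ_{i=0}^{k−1} binom(2n−i, i) · C_{n−i}, where C_m denotes the m-th Catalan number (and terms with i > n are zero). -/

import Mathlib

/-- Steps of a Schröder path: `U` = (1,1), `D` = (1,-1), `H` = (2,0). -/
inductive Step : Type
  | U : Step
  | D : Step
  | H : Step
  deriving DecidableEq

/-- Number of `U` steps of a word. -/
def countU (w : List Step) : ℕ := w.count Step.U

/-- Number of `D` steps of a word. -/
def countD (w : List Step) : ℕ := w.count Step.D

/-- Number of `H` steps of a word. -/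
def countH (w : List Step) : ℕ := w.count Step.H

/-- A word is a Schröder word if every prefix has at least as many `U`'s as `D`'s
and the whole word has equally many `U`'s and `D`'s. -/
def IsSchroder (w : List Step) : Prop :=
  (∀ p : List Step, p <+: w → countD p ≤ countU p) ∧ countU w = countD w

/-- The semilength of a Schröder word. -/
def semilength (w : List Step) : ℕ := countU w + countH w

/-- `schroderAvoidCount n P` is the number of Schröder words of semilength `n`
avoiding the pattern `P` (i.e. not containing `P` as a not-necessarily-contiguous
subword). -/
noncomputable def schroderAvoidCount (n : ℕ) (P : List Step) : ℕ :=
  Nat.card {w : List Step // IsSchroder w ∧ semilength w = n ∧ ¬ P.Sublist w}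

/-- Reversed Schröder prefixes with prescribed letter counts. -/
def revSet (u d h : ℕ) : Set (List Step) :=
  {w | (∀ p : List Step, p <:+ w → countD p ≤ countU p) ∧
    countU w = u ∧ countD w = d ∧ countH w = h}

lemma length_counts (w : List Step) : w.length = countU w + countD w + countH w := by
  induction w with
  | nil => simp [countU, countD, countH]
  | cons a t ih =>
    cases a <;> simp_all [countU, countD, countH] <;> omega

instance finiteStep : Finite Step := by
  refine Finite.of_injective
    (fun s : Step => match s with | .U => (0 : Fin 3) | .D => 1 | .H => 2) ?_
  intro a b
  cases a <;> cases b <;> simp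

lemma revSet_finite (u d h : ℕ) : (revSet u d h).Finite := by
  refine (List.finite_length_eq Step (u + d + h)).subset ?_
  rintro w ⟨_, h1, h2, h3⟩
  simp only [Set.mem_ofPred_eq, length_counts, h1, h2, h3]

lemma revSet_empty {u d : ℕ} (h : ℕ) (hd : u < d) : revSet u d h = ∅ := by
  ext w
  simp only [revSet, Set.mem_ofPred_eq, Set.mem_empty_iff_false, iff_false]
  rintro ⟨h0, h1, h2, _⟩
  have := h0 w List.suffix_rfl
  omega

lemma suffix_cond_cons (a : Step) (w : List Step) :
    (∀ p : List Step, p <:+ a :: w → countD p ≤ countU p) ↔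
      countD (a :: w) ≤ countU (a :: w) ∧ ∀ p : List Step, p <:+ w → countD p ≤ countU p := by
  simp only [List.suffix_cons_iff]
  constructor
  · intro H
    exact ⟨H _ (Or.inl rfl), fun p hp => H p (Or.inr hp)⟩
  · rintro ⟨H1, H2⟩ p (rfl | hp)
    · exact H1
    · exact H2 p hp

lemma revSet_nil_mem {u d h : ℕ} : [] ∈ revSet u d h ↔ u = 0 ∧ d = 0 ∧ h = 0 := by
  simp [revSet, countU, countD, countH, eq_comm]

lemma revSet_cons_U {u d h : ℕ} (hd : d ≤ u) (w : List Step) :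
    Step.U :: w ∈ revSet u d h ↔ 0 < u ∧ w ∈ revSet (u - 1) d h := by
  simp only [revSet, Set.mem_ofPred_eq, suffix_cond_cons]
  simp only [countU, countD, countH, List.count_cons]
  simp
  grind

lemma revSet_cons_D {u d h : ℕ} (hd : d ≤ u) (w : List Step) :
    Step.D :: w ∈ revSet u d h ↔ 0 < d ∧ w ∈ revSet u (d - 1) h := by
  simp only [revSet, Set.mem_ofPred_eq, suffix_cond_cons]
  simp only [countU, countD, countH, List.count_cons]
  simp
  grind

lemma revSet_cons_H {u d h : ℕ} (hd : d ≤ u) (w : List Step) :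
    Step.H :: w ∈ revSet u d h ↔ 0 < h ∧ w ∈ revSet u d (h - 1) := by
  simp only [revSet, Set.mem_ofPred_eq, suffix_cond_cons]
  simp only [countU, countD, countH, List.count_cons]
  simp
  grind

lemma ncard_split (S : Set (List Step)) (hS : S.Finite) (hn : [] ∉ S) :
    S.ncard = {w | Step.U :: w ∈ S}.ncard + {w | Step.D :: w ∈ S}.ncard
      + {w | Step.H :: w ∈ S}.ncard := by
  have inj : ∀ a : Step, Function.Injective (List.cons a) := fun a => List.cons_injective
  have hfin : ∀ a : Step, (List.cons a '' {w | a :: w ∈ S}).Finite := fun a =>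
    hS.subset (by rintro _ ⟨w, hw, rfl⟩; exact hw)
  have hSe : S = (List.cons Step.U '' {w | Step.U :: w ∈ S} ∪
      List.cons Step.D '' {w | Step.D :: w ∈ S}) ∪ List.cons Step.H '' {w | Step.H :: w ∈ S} := by
    ext w
    rcases w with _ | ⟨a, t⟩
    · simp [hn]
    · cases a <;> simp
  conv_lhs => rw [hSe]
  rw [Set.ncard_union_eq _ ((hfin _).union (hfin _)) (hfin _),
    Set.ncard_union_eq _ (hfin _) (hfin _), Set.ncard_image_of_injective _ (inj _),
    Set.ncard_image_of_injective _ (inj _), Set.ncard_image_of_injective _ (inj _)]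
  · rw [Set.disjoint_left]
    rintro _ ⟨w, _, rfl⟩ ⟨v, _, h⟩
    simp at h
  · rw [Set.disjoint_left]
    rintro _ (⟨w, _, rfl⟩ | ⟨w, _, rfl⟩) ⟨v, _, h⟩ <;> simp at h

/-- Ballot numbers. -/
def ballot (u d : ℕ) : ℤ := ((u + d).choose u : ℤ) - ((u + d).choose (u + 1) : ℤ)

lemma ballot_diag_succ (u : ℕ) : ballot u (u + 1) = 0 := by
  have := Nat.choose_symm_half u
  simp only [ballot]
  rw [show u + (u + 1) = 2 * u + 1 by ring, this]; simp

lemma ballot_succ (u d : ℕ) :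
    ballot (u + 1) (d + 1) = ballot u (d + 1) + ballot (u + 1) d := by
  simp only [ballot]
  rw [show u + 1 + (d + 1) = (u + d + 1) + 1 by ring, show u + (d + 1) = u + d + 1 by ring,
    show u + 1 + d = u + d + 1 by ring, Nat.choose_succ_succ (u + d + 1) u,
    Nat.choose_succ_succ (u + d + 1) (u + 1)]
  push_cast
  ring

lemma ballot_zero (u : ℕ) : ballot u 0 = 1 := by simp [ballot]

lemma revSet_ncard (N : ℕ) : ∀ u d h : ℕ, u + d + h = N → d ≤ u + 1 →
    ((revSet u d h).ncard : ℤ) = ((u + d + h).choose h : ℤ) * ballot u d := by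
  induction N with
  | zero =>
    intro u d h hN _
    obtain ⟨rfl, rfl, rfl⟩ : u = 0 ∧ d = 0 ∧ h = 0 := by omega
    have : revSet 0 0 0 = {[]} := by
      ext w
      constructor
      · rintro ⟨_, h1, h2, h3⟩
        have := length_counts w
        rw [h1, h2, h3] at this
        simpa using this
      · rintro rfl
        exact revSet_nil_mem.2 ⟨rfl, rfl, rfl⟩
    simp [this, ballot]
  | succ N ih =>
    intro u d h hN hd
    rcases Nat.lt_or_ge u d with hlt | hle
    · obtain rfl : d = u + 1 := by omega
      rw [revSet_empty h hlt, ballot_diag_succ]; simp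
    rw [ncard_split _ (revSet_finite u d h) (by rw [revSet_nil_mem]; omega)]
    simp only [revSet_cons_U hle, revSet_cons_D hle, revSet_cons_H hle]
    rcases u with _ | u
    · obtain rfl : d = 0 := by omega
      rcases h with _ | h
      · omega
      · have := ih 0 0 h (by omega) (by omega)
        simp_all [ballot]
    · have iU := ih u d h (by omega) (by omega)
      rcases d with _ | d
      · rcases h with _ | h
        · simp_all [ballot_zero]
        · have iH := ih (u + 1) 0 h (by omega) (by omega)
          simp [ballot_zero] at iU iH ⊢
          rw [iU, iH, show u + 1 + (h + 1) = (u + 1 + h) + 1 by ring,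
            Nat.choose_succ_succ (u + 1 + h) h, show u + (h + 1) = u + 1 + h by ring]
          push_cast; ring
      · have iD := ih (u + 1) d h (by omega) (by omega)
        rcases h with _ | h
        · simp at iU iD ⊢
          rw [iU, iD, ballot_succ]
        · have iH := ih (u + 1) (d + 1) h (by omega) (by omega)
          simp at iU iD iH ⊢
          rw [iU, iD, iH, ballot_succ,
            show u + 1 + (d + 1) + (h + 1) = (u + 1 + (d + 1) + h) + 1 by ring,
            Nat.choose_succ_succ (u + 1 + (d + 1) + h) h,
            show u + (d + 1) + (h + 1) = u + 1 + (d + 1) + h by ring,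
            show u + 1 + d + (h + 1) = u + 1 + (d + 1) + h by ring]
          push_cast; ring

lemma ballot_diag (n : ℕ) : ballot n n = catalan n := by
  have h1 := succ_mul_catalan_eq_centralBinom n
  have h2 := Nat.choose_succ_right_eq (2 * n) n
  rw [show 2 * n - n = n by omega] at h2
  rw [Nat.centralBinom_eq_two_mul_choose] at h1
  simp only [ballot, ← two_mul]
  have hcat : ((n : ℤ) + 1) * catalan n = (2 * n).choose n := by exact_mod_cast h1
  have hcho : ((2 * n).choose (n + 1) : ℤ) * (n + 1) = (2 * n).choose n * n := by exact_mod_cast h2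
  have h0 : (n : ℤ) + 1 ≠ 0 := by positivity
  apply mul_left_cancel₀ h0
  linear_combination -hcat - hcho

/-- Schröder words of semilength `n` with exactly `i` horizontal steps. -/
def layer (n i : ℕ) : Set (List Step) :=
  {w | IsSchroder w ∧ semilength w = n ∧ countH w = i}

lemma layer_eq {n i : ℕ} (hi : i ≤ n) :
    layer n i = List.reverse '' revSet (n - i) (n - i) i := by
  ext w
  simp only [layer, revSet, IsSchroder, semilength, Set.mem_ofPred_eq, Set.mem_image]
  have key : ∀ v : List Step, (∀ p, p <+: v.reverse → countD p ≤ countU p) ↔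
      (∀ p, p <:+ v → countD p ≤ countU p) := by
    intro v
    constructor
    · intro H p hp
      have := H p.reverse (List.reverse_prefix.2 hp)
      simpa [countD, countU] using this
    · intro H p hp
      have := H p.reverse (by rw [← List.reverse_prefix]; simpa using hp)
      simpa [countD, countU] using this
  have cr : ∀ v : List Step, countU v.reverse = countU v ∧ countD v.reverse = countD v ∧
      countH v.reverse = countH v := by
    intro v; simp [countU, countD, countH]
  constructor
  · rintro ⟨⟨h1, h2⟩, h3, h4⟩
    obtain ⟨c1, c2, c3⟩ := cr w
    refine ⟨w.reverse, ⟨(key _).1 (by simpa using h1), ?_, ?_, ?_⟩, by simp⟩ <;> omega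
  · rintro ⟨v, ⟨h1, h2, h3, h4⟩, rfl⟩
    obtain ⟨c1, c2, c3⟩ := cr v
    refine ⟨⟨(key _).2 h1, ?_⟩, ?_, ?_⟩ <;> omega

lemma layer_empty {n i : ℕ} (hi : n < i) : layer n i = ∅ := by
  ext w
  simp only [layer, semilength, Set.mem_ofPred_eq, Set.mem_empty_iff_false, iff_false]
  omega

lemma layer_finite (n i : ℕ) : (layer n i).Finite := by
  rcases Nat.lt_or_ge n i with h | h
  · rw [layer_empty h]; exact Set.finite_empty
  · rw [layer_eq h]; exact (revSet_finite _ _ _).image _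

lemma layer_ncard (n i : ℕ) :
    (layer n i).ncard = Nat.choose (2 * n - i) i * catalan (n - i) := by
  rcases Nat.lt_or_ge n i with h | h
  · rw [layer_empty h, Nat.choose_eq_zero_of_lt (by omega)]; simp
  · rw [layer_eq h, Set.ncard_image_of_injective _ List.reverse_injective]
    have := revSet_ncard _ (n - i) (n - i) i rfl (by omega)
    rw [ballot_diag, show n - i + (n - i) + i = 2 * n - i by omega] at this
    exact_mod_cast this

lemma layers_ncard (n k : ℕ) :
    {w | IsSchroder w ∧ semilength w = n ∧ countH w < k}.Finite ∧
    {w | IsSchroder w ∧ semilength w = n ∧ countH w < k}.ncard =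
      ∑ i ∈ Finset.range k, Nat.choose (2 * n - i) i * catalan (n - i) := by
  induction k with
  | zero => simp
  | succ k ih =>
    have e : {w | IsSchroder w ∧ semilength w = n ∧ countH w < k + 1} =
        {w | IsSchroder w ∧ semilength w = n ∧ countH w < k} ∪ layer n k := by
      ext w
      simp only [layer, Set.mem_ofPred_eq, Set.mem_union, Nat.lt_succ_iff_lt_or_eq]
      tauto
    rw [e]
    refine ⟨ih.1.union (layer_finite n k), ?_⟩
    rw [Set.ncard_union_eq _ ih.1 (layer_finite n k), ih.2, layer_ncard, Finset.sum_range_succ]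
    rw [Set.disjoint_left]
    rintro w ⟨_, _, h1⟩ ⟨_, _, h2⟩
    omega

theorem schroder_avoid_Hk (n k : ℕ) (hk : 1 ≤ k) :
    schroderAvoidCount n (List.replicate k Step.H) =
      ∑ i ∈ Finset.range k, Nat.choose (2 * n - i) i * catalan (n - i) := by
  rw [← (layers_ncard n k).2, schroderAvoidCount, ← Nat.card_coe_set_eq]
  simp only [List.replicate_sublist_iff, not_le, countH]
  rfl
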